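/- Let a directed graph on finite vertex set V, |V| = n, with source s ∈ V, have finite edge set E ∪ Ê with incidence matrix B and lengths ℓ ∈ ℝ^{E∪Ê}. Let p ≥ 2 be an integer, δ_e ≥ 0 for e ∈ E, m ≥ 2 with |E| + |Ê| ≤ 2m, α > 0, F > 0, F* = (1−α)F. Suppose f ∈ ℝ^{E∪Ê} is entrywise nonnegative with f_e + δ_e > 0 for e ∈ E and f_e > 0 for e ∈ Ê, routes the demand d given by d_s = n−1 and d_v = −1 for v ≠ s, and satisfies (1−α/2)F ≤ ℓ^⊤f ≤ (1+5α)F and ∑_{e∈Ê} f_e^{−p} ≤ 100·p·m·log m (the latter follows as in the paper from Φ(f) ≤ 20m·log m). Let s̄ := ℓ^⊤f − F* and let w_e = 1/(f_e+δ_e) for e ∈ E, w_e = W_p(f_e) for e ∈ Ê. Suppose φ̂ ∈ ℝ^V satisfies φ̂(s) = 0 and, for every edge e from u to v, 0 ≤ ℓ_e − (φ̂(v) − φ̂(u)) ≤ 2·(s̄/(10m))·w_e. Then ∑_{v∈V} φ̂(v) ≥ (1 − 150·α·p·log m)·F. -/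

import Mathlib

open Sum

/-- The weight function `W_p`: `W_p(x) = x^{-(p+1)}` for `x ≤ 1`, `W_p(x) = 1/x` for `x ≥ 1`. -/
noncomputable def barrierW (p : ℕ) (x : ℝ) : ℝ :=
  if x ≤ 1 then x ^ (-(p : ℤ) - 1) else 1 / x

/-- `f` routes the demand `d` in the directed graph given by `tail`, `head`. -/
def Routes {Edge V : Type*} [Fintype Edge] [DecidableEq V]
    (tail head : Edge → V) (f : Edge → ℝ) (d : V → ℝ) : Prop :=
  ∀ u : V, ((∑ e, if tail e = u then f e else 0) - ∑ e, if head e = u then f e else 0) = d u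

/-- Summation by parts: the pairing of a flow with potential differences is minus the pairing of
its demand with the potential. -/
theorem Routes.sum_mul_potential_diff {Edge V : Type*} [Fintype Edge] [Fintype V] [DecidableEq V]
    {tail head : Edge → V} {f : Edge → ℝ} {d : V → ℝ} (h : Routes tail head f d) (φ : V → ℝ) :
    ∑ e, f e * (φ (head e) - φ (tail e)) = -∑ u, φ u * d u := by
  have key (g : Edge → V) :
      ∑ u, φ u * (∑ e, if g e = u then f e else 0) = ∑ e, f e * φ (g e) := by
    simp_rw [Finset.mul_sum]
    rw [Finset.sum_comm]
    refine Finset.sum_congr rfl fun e _ => ?_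
    simp [mul_comm]
  have hd : ∑ u, φ u * d u = ∑ e, f e * φ (tail e) - ∑ e, f e * φ (head e) := by
    rw [← key tail, ← key head, ← Finset.sum_sub_distrib]
    refine Finset.sum_congr rfl fun u _ => ?_
    rw [← h u, mul_sub]
  simp_rw [hd, mul_sub, Finset.sum_sub_distrib]
  ring

theorem mul_barrierW_le (p : ℕ) {x : ℝ} (hx : 0 < x) :
    x * barrierW p x ≤ 1 + x ^ (-(p : ℤ)) := by
  have hpos : 0 < x ^ (-(p : ℤ)) := zpow_pos hx _
  unfold barrierW
  split_ifs
  · rw [zpow_sub_one₀ hx.ne', mul_comm, inv_mul_cancel_right₀ hx.ne']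
    linarith
  · rw [mul_one_div_cancel hx.ne']
    linarith

/-- last part of Lemma `phiprop`: the rescaled dual potentials `φ̂` are large
on average: `∑_v φ̂(v) ≥ (1 − 150·α·p·log m)·F`. -/
theorem dual_potential_sum_large {V E Ehat : Type*} [Fintype V] [DecidableEq V] [Fintype E] [Fintype Ehat]
    (s : V)
    (tail head : E ⊕ Ehat → V) (ℓ : E ⊕ Ehat → ℝ)
    (p : ℕ) (hp : 2 ≤ p)
    (δ : E → ℝ) (hδ : ∀ e, 0 ≤ δ e)
    (m : ℝ) (hm : 2 ≤ m)
    (hcard : (Fintype.card E : ℝ) + (Fintype.card Ehat : ℝ) ≤ 2 * m)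
    (α : ℝ) (hα : 0 < α) (F : ℝ) (hF : 0 < F)
    (f : E ⊕ Ehat → ℝ) (hfnn : ∀ e, 0 ≤ f e)
    (hf2 : ∀ e : E, 0 < f (inl e) + δ e)
    (hf3 : ∀ e : Ehat, 0 < f (inr e))
    (hroutes : Routes tail head f
      (fun u => if u = s then (Fintype.card V : ℝ) - 1 else -1))
    (hcost1 : (1 - α / 2) * F ≤ ∑ e, ℓ e * f e)
    (hcost2 : ∑ e, ℓ e * f e ≤ (1 + 5 * α) * F)
    (hbarrier : ∑ e : Ehat, (f (inr e)) ^ (-(p : ℤ)) ≤ 100 * p * m * Real.log m)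
    (φ : V → ℝ) (hφs : φ s = 0)
    (hφ : ∀ e, 0 ≤ ℓ e - (φ (head e) - φ (tail e)) ∧
      ℓ e - (φ (head e) - φ (tail e)) ≤
        2 * ((∑ e', ℓ e' * f e' - (1 - α) * F) / (10 * m)) *
          (Sum.elim (fun e' => 1 / (f (inl e') + δ e'))
            (fun e' => barrierW p (f (inr e'))) e)) :
    (1 - 150 * α * p * Real.log m) * F ≤ ∑ v, φ v := by
  set C := ∑ e, ℓ e * f e with hC
  set S := C - (1 - α) * F with hS
  set w : E ⊕ Ehat → ℝ := Sum.elim (fun e' => 1 / (f (inl e') + δ e'))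
    (fun e' => barrierW p (f (inr e'))) with hw
  have hαF : 0 < α * F := mul_pos hα hF
  have hS0 : 0 ≤ S := by nlinarith
  have hS6 : S ≤ 6 * (α * F) := by nlinarith
  have hm0 : 0 < m := by linarith
  have hpL : 1 ≤ p * Real.log m := by
    have h1 : Real.log 2 ≤ Real.log m := Real.log_le_log (by norm_num) hm
    have h2 : (2 : ℝ) ≤ p := by exact_mod_cast hp
    nlinarith [Real.log_two_gt_d9]
  have hdem : ∑ u, φ u * (if u = s then (Fintype.card V : ℝ) - 1 else -1) = -∑ u, φ u := by
    rw [← Finset.sum_neg_distrib]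
    refine Finset.sum_congr rfl fun u _ => ?_
    split_ifs with h
    · simp [h, hφs]
    · ring
  have hgap : ∑ e, f e * (ℓ e - (φ (head e) - φ (tail e))) = C - ∑ v, φ v := by
    simp_rw [mul_sub (f _) (ℓ _), Finset.sum_sub_distrib]
    rw [hroutes.sum_mul_potential_diff φ, hdem, neg_neg, hC]
    simp_rw [mul_comm (f _)]
  have hweight : ∑ e, f e * w e ≤ 2 * m + 100 * p * m * Real.log m := by
    have hE : ∑ e : E, f (inl e) * w (inl e) ≤ Fintype.card E := by
      have : ∑ e : E, f (inl e) * w (inl e) ≤ ∑ _e : E, (1 : ℝ) := by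
        refine Finset.sum_le_sum fun e _ => ?_
        simp only [hw, Sum.elim_inl, mul_one_div]
        exact (div_le_one (hf2 e)).2 (by linarith [hδ e])
      simpa using this
    have hEhat : ∑ e : Ehat, f (inr e) * w (inr e) ≤
        Fintype.card Ehat + ∑ e : Ehat, (f (inr e)) ^ (-(p : ℤ)) := by
      have : ∑ e : Ehat, f (inr e) * w (inr e) ≤
          ∑ e : Ehat, (1 + (f (inr e)) ^ (-(p : ℤ))) :=
        Finset.sum_le_sum fun e _ => mul_barrierW_le p (hf3 e)
      simpa [Finset.sum_add_distrib] using this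
    rw [Fintype.sum_sum_type]
    linarith
  have hle : C - ∑ v, φ v ≤ 2 * (S / (10 * m)) * ∑ e, f e * w e := by
    rw [← hgap, Finset.mul_sum]
    refine Finset.sum_le_sum fun e _ => ?_
    rw [mul_left_comm]
    exact mul_le_mul_of_nonneg_left (hφ e).2 (hfnn e)
  have hbound : 2 * (S / (10 * m)) * ∑ e, f e * w e ≤ S * (2 / 5 + 20 * (p * Real.log m)) := by
    refine (mul_le_mul_of_nonneg_left hweight (by positivity)).trans_eq ?_
    field_simp
    ring
  have h1 : S * (p * Real.log m) ≤ 6 * (α * F) * (p * Real.log m) :=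
    mul_le_mul_of_nonneg_right hS6 (by linarith)
  have h2 : α * F * 1 ≤ α * F * (p * Real.log m) := mul_le_mul_of_nonneg_left hpL hαF.le
  have hCS : C = S + (1 - α) * F := by rw [hS]; ring
  linarith
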